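/- Let c = 2.468155 and λ = 2c. There exists a pair (φ0, φ1) with φ2 := 1 − φ0 − φ1, 0.26 < φ0 < 0.4, 0.26 < φ1 < 0.4, 0.26 < φ2 < 0.4, satisfying λ·φ0 = Σ_{x=0}^{∞} x·p_x·A0(x,φ)/B(x,φ) and λ·φ1 = Σ_{x=0}^{∞} x·p_x·A1(x,φ)/B(x,φ), for which 2^(−c) · exp( Σ_{x=0}^{∞} p_x · log B(x,φ) ) · (1 − 2φ0)^((1 − 4φ0)·c) · (1 − 2φ1)^((1 − 4φ1)·c) · (1 − 2φ2)^((1 − 4φ2)·c) < 1. -/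

import Mathlib

/-- The Poisson probability `p(x, λ) = e^(−λ) λ^x / x!`. -/
noncomputable def poisson (lam : ℝ) (x : ℕ) : ℝ :=
  Real.exp (-lam) * lam ^ x / (Nat.factorial x)

/-- `A0(x, φ) = max(0, 2^x − 2) (1 − 2φ0)^x`. -/
noncomputable def A0 (phi0 : ℝ) (x : ℕ) : ℝ := max 0 ((2 : ℝ) ^ x - 2) * (1 - 2 * phi0) ^ x

/-- `A1(x, φ) = (2^x − 1) (1 − 2φ1)^x`. -/
noncomputable def A1 (phi1 : ℝ) (x : ℕ) : ℝ := ((2 : ℝ) ^ x - 1) * (1 - 2 * phi1) ^ x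

/-- `A2(x, φ) = 2^x (1 − 2φ2)^x`. -/
noncomputable def A2 (phi2 : ℝ) (x : ℕ) : ℝ := (2 : ℝ) ^ x * (1 - 2 * phi2) ^ x

/-- `B(x, φ) = A0(x, φ) + A1(x, φ) + A2(x, φ)`. -/
noncomputable def B (phi0 phi1 phi2 : ℝ) (x : ℕ) : ℝ :=
  A0 phi0 x + A1 phi1 x + A2 phi2 x

section PoissonGibbs

open Finset

lemma poisson_nonneg {lam : ℝ} (h : 0 ≤ lam) (x : ℕ) : 0 ≤ poisson lam x := by
  unfold poisson; positivity

lemma poisson_eq (lam : ℝ) (x : ℕ) :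
    poisson lam x = Real.exp (-lam) * (lam ^ x / x.factorial) := by
  rw [poisson, mul_div_assoc]

lemma hasSum_poisson (lam : ℝ) : HasSum (poisson lam) 1 := by
  have h := NormedSpace.expSeries_div_hasSum_exp lam
  rw [← Real.exp_eq_exp_ℝ] at h
  have h2 := h.mul_left (Real.exp (-lam))
  rw [← Real.exp_add, neg_add_cancel, Real.exp_zero] at h2
  simpa only [funext (poisson_eq lam)] using h2

lemma succ_mul_poisson_succ (lam : ℝ) (x : ℕ) :
    ((x : ℝ) + 1) * poisson lam (x + 1) = lam * poisson lam x := by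
  have h : ((x : ℝ) + 1) ≠ 0 := by positivity
  have h' : (x.factorial : ℝ) ≠ 0 := by positivity
  simp only [poisson, Nat.factorial_succ, pow_succ]
  push_cast
  field_simp

lemma hasSum_mul_poisson (lam : ℝ) : HasSum (fun x : ℕ => (x : ℝ) * poisson lam x) lam := by
  have h := (hasSum_poisson lam).mul_left lam
  rw [mul_one] at h
  refine (hasSum_nat_add_iff' 1).1 ?_
  simpa [succ_mul_poisson_succ] using h

/-- The combinatorial weights multiplying the powers `(1 - 2 φ_i) ^ x`. -/
noncomputable def weight : Fin 3 → ℕ → ℝ :=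
  ![fun x => max 0 (2 ^ x - 2), fun x => 2 ^ x - 1, fun x => 2 ^ x]

/-- The sum `B` as a function of the logarithms `u i = log (1 - 2 φ_i)`. -/
noncomputable def partitionSum (u : Fin 3 → ℝ) (x : ℕ) : ℝ :=
  ∑ i, weight i x * Real.exp (u i) ^ x

/-- The share of the `i`-th summand in `partitionSum`. -/
noncomputable def gibbs (u : Fin 3 → ℝ) (i : Fin 3) (x : ℕ) : ℝ :=
  weight i x * Real.exp (u i) ^ x / partitionSum u x

lemma weight_nonneg (i : Fin 3) (x : ℕ) : 0 ≤ weight i x := by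
  have h : (1 : ℝ) ≤ 2 ^ x := one_le_pow₀ (by norm_num)
  fin_cases i <;> simp [weight, h]

lemma weight_le (i : Fin 3) (x : ℕ) : weight i x ≤ 2 ^ x := by
  fin_cases i <;> simp [weight]

lemma exp_pow_le_partitionSum (u : Fin 3 → ℝ) (x : ℕ) :
    Real.exp (u 2) ^ x ≤ partitionSum u x := by
  have h : (1 : ℝ) ≤ weight 2 x := one_le_pow₀ (by norm_num)
  calc Real.exp (u 2) ^ x ≤ weight 2 x * Real.exp (u 2) ^ x :=
        le_mul_of_one_le_left (by positivity) h
    _ ≤ partitionSum u x := single_le_sum (f := fun i => weight i x * Real.exp (u i) ^ x)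
        (fun i _ => mul_nonneg (weight_nonneg i x) (by positivity)) (mem_univ 2)

lemma partitionSum_pos (u : Fin 3 → ℝ) (x : ℕ) : 0 < partitionSum u x :=
  lt_of_lt_of_le (by positivity) (exp_pow_le_partitionSum u x)

lemma gibbs_nonneg (u : Fin 3 → ℝ) (i : Fin 3) (x : ℕ) : 0 ≤ gibbs u i x :=
  div_nonneg (mul_nonneg (weight_nonneg i x) (by positivity)) (partitionSum_pos u x).le

lemma sum_gibbs (u : Fin 3 → ℝ) (x : ℕ) : ∑ i, gibbs u i x = 1 := by
  simp only [gibbs, ← sum_div]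
  exact div_self (partitionSum_pos u x).ne'

lemma gibbs_le_one (u : Fin 3 → ℝ) (i : Fin 3) (x : ℕ) : gibbs u i x ≤ 1 := by
  rw [← sum_gibbs u x]
  exact single_le_sum (f := fun i => gibbs u i x) (fun i _ => gibbs_nonneg u i x) (mem_univ i)

lemma abs_log_partitionSum_le {u : Fin 3 → ℝ} (hu : ∀ i, |u i| ≤ 2) (x : ℕ) :
    |Real.log (partitionSum u x)| ≤ 3 * x + 2 := by
  have hx : (0 : ℝ) ≤ x := x.cast_nonneg
  rw [abs_le]
  constructor
  · have h : Real.exp (x * u 2) ≤ partitionSum u x := by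
      rw [Real.exp_nat_mul]; exact exp_pow_le_partitionSum u x
    have h1 := (Real.le_log_iff_exp_le (partitionSum_pos u x)).2 h
    nlinarith [(abs_le.1 (hu 2)).1]
  · rw [Real.log_le_iff_le_exp (partitionSum_pos u x)]
    have h2 : (2 : ℝ) ≤ Real.exp 1 := by linarith [Real.exp_one_gt_d9]
    have h3 : (3 : ℝ) ≤ Real.exp 1 ^ 2 := by nlinarith [Real.exp_one_gt_d9]
    have hterm : ∀ i ∈ (univ : Finset (Fin 3)),
        weight i x * Real.exp (u i) ^ x ≤ Real.exp 1 ^ x * Real.exp 2 ^ x := fun i _ => by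
      have := (abs_le.1 (hu i)).2
      have := (weight_le i x).trans (pow_le_pow_left₀ (by norm_num) h2 x)
      gcongr
    have hsum := sum_le_sum hterm
    rw [sum_const, card_univ, Fintype.card_fin, nsmul_eq_mul] at hsum
    have e : Real.exp (3 * x + 2) = Real.exp 1 ^ 2 * (Real.exp 1 ^ x * Real.exp 2 ^ x) := by
      simp only [← Real.exp_nat_mul, ← Real.exp_add]
      congr 1; push_cast; ring
    rw [e]
    refine hsum.trans ?_
    push_cast
    gcongr

lemma log_partitionSum_ge (u v : Fin 3 → ℝ) (x : ℕ) :
    Real.log (partitionSum v x) + x * ∑ i, gibbs v i x * (u i - v i) ≤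
      Real.log (partitionSum u x) := by
  set s : ℝ := x * ∑ i, gibbs v i x * (u i - v i) with hs
  rw [Real.le_log_iff_exp_le (partitionSum_pos u x), Real.exp_add,
    Real.exp_log (partitionSum_pos v x)]
  have key : ∀ i, gibbs v i x * (1 + (x * (u i - v i) - s)) * (partitionSum v x * Real.exp s) ≤
      weight i x * Real.exp (u i) ^ x := fun i => by
    have h1 := Real.add_one_le_exp (x * (u i - v i) - s)
    have hZ := partitionSum_pos v x
    have e : weight i x * Real.exp (u i) ^ x =
        gibbs v i x * Real.exp (x * (u i - v i) - s) * (partitionSum v x * Real.exp s) := by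
      have : Real.exp (u i) ^ x =
          Real.exp (v i) ^ x * (Real.exp (x * (u i - v i) - s) * Real.exp s) := by
        simp only [← Real.exp_nat_mul, ← Real.exp_add]
        congr 1; ring
      rw [this, gibbs]
      field_simp
    rw [e]
    have := gibbs_nonneg v i x
    gcongr
    linarith
  have hsum := sum_le_sum fun i (_ : i ∈ (univ : Finset (Fin 3))) => key i
  rw [← sum_mul] at hsum
  have e : ∑ i, gibbs v i x * (1 + (x * (u i - v i) - s)) = 1 := by
    have : ∀ i, gibbs v i x * (1 + (x * (u i - v i) - s)) =
        (1 - s) * gibbs v i x + x * (gibbs v i x * (u i - v i)) := fun i => by ring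
    simp only [this, sum_add_distrib, ← mul_sum, sum_gibbs, ← hs]
    ring
  rwa [e, one_mul] at hsum

lemma hasDerivAt_log_partitionSum (u : Fin 3 → ℝ) (i : Fin 3) (x : ℕ) (t : ℝ) :
    HasDerivAt (fun t => Real.log (partitionSum (Function.update u i t) x))
      (x * gibbs (Function.update u i t) i x) t := by
  have h1 : ∀ j, HasDerivAt (fun t => weight j x * Real.exp (Function.update u i t j) ^ x)
      (weight j x * (Real.exp (x * Function.update u i t j) *
        (x * (Pi.single i (1 : ℝ) : Fin 3 → ℝ) j))) t := fun j => by
    simp only [← Real.exp_nat_mul]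
    exact (((hasDerivAt_pi.1 (hasDerivAt_update u i t) j).const_mul (x : ℝ)).exp).const_mul _
  have h2 := (HasDerivAt.fun_sum fun j (_ : j ∈ (univ : Finset (Fin 3))) => h1 j).log
    (partitionSum_pos (Function.update u i t) x).ne'
  refine h2.congr_deriv ?_
  rw [sum_eq_single i]
  · simp only [gibbs, Real.exp_nat_mul, Pi.single_eq_same]
    rw [partitionSum]; ring
  · intro j _ hj; simp [hj]
  · simp

lemma continuous_log_partitionSum (x : ℕ) :
    Continuous fun u => Real.log (partitionSum u x) := by
  refine Continuous.log ?_ fun u => (partitionSum_pos u x).ne'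
  unfold partitionSum
  fun_prop

/-- The Poisson average of `log (partitionSum u x)`. -/
noncomputable def poissonLog (lam : ℝ) (u : Fin 3 → ℝ) : ℝ :=
  ∑' x, poisson lam x * Real.log (partitionSum u x)

/-- The partial derivative of `poissonLog` in the `i`-th variable. -/
noncomputable def gibbsMean (lam : ℝ) (u : Fin 3 → ℝ) (i : Fin 3) : ℝ :=
  ∑' x : ℕ, x * poisson lam x * gibbs u i x

lemma summable_poisson_bound (lam : ℝ) :
    Summable fun x : ℕ => poisson lam x * (3 * x + 2) := by
  have := ((hasSum_mul_poisson lam).summable.mul_left 3).add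
    ((hasSum_poisson lam).summable.mul_left 2)
  refine this.congr fun x => by ring

lemma norm_poisson_log_le {lam : ℝ} (hl : 0 ≤ lam) {u : Fin 3 → ℝ} (hu : ∀ i, |u i| ≤ 2) (x : ℕ) :
    ‖poisson lam x * Real.log (partitionSum u x)‖ ≤ poisson lam x * (3 * x + 2) := by
  rw [norm_mul, Real.norm_of_nonneg (poisson_nonneg hl x)]
  exact mul_le_mul_of_nonneg_left (abs_log_partitionSum_le hu x) (poisson_nonneg hl x)

lemma summable_poisson_log {lam : ℝ} (hl : 0 ≤ lam) {u : Fin 3 → ℝ} (hu : ∀ i, |u i| ≤ 2) :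
    Summable fun x => poisson lam x * Real.log (partitionSum u x) :=
  .of_norm_bounded (summable_poisson_bound lam) (norm_poisson_log_le hl hu)

lemma norm_mul_poisson_gibbs_le {lam : ℝ} (hl : 0 ≤ lam) (u : Fin 3 → ℝ) (i : Fin 3) (x : ℕ) :
    ‖x * poisson lam x * gibbs u i x‖ ≤ x * poisson lam x := by
  have h := mul_nonneg x.cast_nonneg (poisson_nonneg hl x)
  rw [Real.norm_of_nonneg (mul_nonneg h (gibbs_nonneg u i x))]
  exact mul_le_of_le_one_right h (gibbs_le_one u i x)

lemma summable_mul_poisson_gibbs {lam : ℝ} (hl : 0 ≤ lam) (u : Fin 3 → ℝ) (i : Fin 3) :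
    Summable fun x : ℕ => x * poisson lam x * gibbs u i x :=
  .of_norm_bounded (hasSum_mul_poisson lam).summable (norm_mul_poisson_gibbs_le hl u i)

lemma sum_gibbsMean {lam : ℝ} (hl : 0 ≤ lam) (u : Fin 3 → ℝ) : ∑ i, gibbsMean lam u i = lam := by
  unfold gibbsMean
  rw [← Summable.tsum_finsetSum fun i _ => summable_mul_poisson_gibbs hl u i]
  conv_rhs => rw [← (hasSum_mul_poisson lam).tsum_eq]
  refine tsum_congr fun x => ?_
  rw [← mul_sum, sum_gibbs, mul_one]

lemma continuousOn_poissonLog {lam : ℝ} (hl : 0 ≤ lam) :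
    ContinuousOn (poissonLog lam) {u | ∀ i, |u i| ≤ 2} :=
  continuousOn_tsum
    (fun x => (continuous_const.mul (continuous_log_partitionSum x)).continuousOn)
    (summable_poisson_bound lam) fun x _ hu => norm_poisson_log_le hl hu x

lemma hasDerivAt_poissonLog {lam : ℝ} (hl : 0 ≤ lam) {u : Fin 3 → ℝ} (hu : ∀ i, |u i| ≤ 2)
    (i : Fin 3) :
    HasDerivAt (fun t => poissonLog lam (Function.update u i t)) (gibbsMean lam u i) (u i) := by
  have h := hasDerivAt_tsum (y₀ := u i) (hasSum_mul_poisson lam).summable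
    (fun x t => (hasDerivAt_log_partitionSum u i x t).const_mul (poisson lam x))
    (fun x t => by
      rw [← mul_assoc, mul_comm (poisson lam x)]
      exact norm_mul_poisson_gibbs_le hl _ i x)
    (by simpa using summable_poisson_log hl hu) (u i)
  refine h.congr_deriv ?_
  unfold gibbsMean
  refine tsum_congr fun x => ?_
  rw [Function.update_eq_self]; ring

lemma poissonLog_ge {lam : ℝ} (hl : 0 ≤ lam) {u v : Fin 3 → ℝ} (hu : ∀ i, |u i| ≤ 2)
    (hv : ∀ i, |v i| ≤ 2) :
    poissonLog lam v + ∑ i, gibbsMean lam v i * (u i - v i) ≤ poissonLog lam u := by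
  have hs := fun i => (summable_mul_poisson_gibbs hl v i).mul_right (u i - v i)
  unfold poissonLog gibbsMean
  simp only [← tsum_mul_right]
  rw [← Summable.tsum_finsetSum fun i _ => hs i,
    ← (summable_poisson_log hl hv).tsum_add (summable_sum fun i _ => hs i)]
  refine Summable.tsum_le_tsum (fun x => ?_)
    ((summable_poisson_log hl hv).add (summable_sum fun i _ => hs i)) (summable_poisson_log hl hu)
  have := mul_le_mul_of_nonneg_left (log_partitionSum_ge u v x) (poisson_nonneg hl x)
  refine le_trans (le_of_eq ?_) this
  rw [mul_add, mul_sum, mul_sum]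
  congr 1
  exact sum_congr rfl fun i _ => by ring

/-- The convex function whose critical points solve the fixed-point system. -/
noncomputable def freeEnergy (c : ℝ) (u : Fin 3 → ℝ) : ℝ :=
  poissonLog (2 * c) u - c * ∑ i, (u i - Real.exp (u i))

lemma hasDerivAt_freeEnergy {c : ℝ} (hc : 0 ≤ c) {u : Fin 3 → ℝ} (hu : ∀ i, |u i| ≤ 2)
    (i : Fin 3) :
    HasDerivAt (fun t => freeEnergy c (Function.update u i t))
      (gibbsMean (2 * c) u i - c * (1 - Real.exp (u i))) (u i) := by
  have h1 : ∀ j, HasDerivAt (fun t => Function.update u i t j - Real.exp (Function.update u i t j))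
      ((Pi.single i (1 : ℝ) : Fin 3 → ℝ) j -
        Real.exp (Function.update u i (u i) j) * (Pi.single i (1 : ℝ) : Fin 3 → ℝ) j) (u i) :=
    fun j => by
      have h := hasDerivAt_pi.1 (hasDerivAt_update u i (u i)) j
      exact h.sub h.exp
  have h2 := (hasDerivAt_poissonLog (by positivity : 0 ≤ 2 * c) hu i).sub
    ((HasDerivAt.fun_sum fun j (_ : j ∈ (univ : Finset (Fin 3))) => h1 j).const_mul c)
  refine h2.congr_deriv ?_
  rw [sum_eq_single i]
  · simp
  · intro j _ hj; simp [hj]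
  · simp

lemma one_add_add_sq_le_exp {d : ℝ} (hd : |d| ≤ 1) : 1 + d + d ^ 2 / 4 ≤ Real.exp d := by
  have h := (abs_le.1 (Real.exp_bound hd (n := 3) (by norm_num))).1
  have h3 : |d| ^ 3 ≤ d ^ 2 := by
    rw [pow_succ, sq_abs]
    exact mul_le_of_le_one_right (sq_nonneg d) hd
  norm_num [sum_range_succ, Nat.factorial] at h
  linarith [sq_nonneg d]

lemma freeEnergy_ge {c : ℝ} (hc : 0 ≤ c) {u v : Fin 3 → ℝ} (hu : ∀ i, |u i| ≤ 2)
    (hv : ∀ i, |v i| ≤ 2) (huv : ∀ i, |u i - v i| ≤ 1) :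
    freeEnergy c v + ∑ i, (gibbsMean (2 * c) v i - c * (1 - Real.exp (v i))) * (u i - v i) +
      c / 4 * ∑ i, Real.exp (v i) * (u i - v i) ^ 2 ≤ freeEnergy c u := by
  have h1 := poissonLog_ge (by positivity : 0 ≤ 2 * c) hu hv
  have h2 : ∀ i, c * (Real.exp (v i) * (1 + (u i - v i) + (u i - v i) ^ 2 / 4)) ≤
      c * Real.exp (u i) := fun i => by
    have e : Real.exp (u i) = Real.exp (v i) * Real.exp (u i - v i) := by
      rw [← Real.exp_add]; congr 1; ring
    rw [e]
    have := one_add_add_sq_le_exp (huv i)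
    gcongr
  have h20 := h2 0
  have h21 := h2 1
  have h22 := h2 2
  simp only [freeEnergy, Fin.sum_univ_three] at h1 ⊢
  linarith

/-- If the gradient of `freeEnergy c` at `v` is small, there is a critical point close to `v`. -/
lemma exists_critical {c r ε m : ℝ} {v : Fin 3 → ℝ} (hc : 0 ≤ c) (hr : 0 < r) (hr1 : r ≤ 1)
    (hε : 0 ≤ ε) (hv : ∀ i, |v i| + r ≤ 2) (hm : ∀ i, m ≤ Real.exp (v i))
    (hsum : ∑ i, Real.exp (v i) = 1)
    (hgrad : ∀ i, c * (1 - Real.exp (v i)) - ε ≤ gibbsMean (2 * c) v i)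
    (hsmall : 6 * ε < c / 4 * m * r) :
    ∃ u : Fin 3 → ℝ, (∀ i, |u i - v i| ≤ r) ∧ freeEnergy c u ≤ freeEnergy c v ∧
      ∀ i, gibbsMean (2 * c) u i = c * (1 - Real.exp (u i)) := by
  set K : Set (Fin 3 → ℝ) := Set.univ.pi fun i => Set.Icc (v i - r) (v i + r) with hK
  have memK : ∀ u, u ∈ K ↔ ∀ i, |u i - v i| ≤ r := fun u => by
    simp only [hK, Set.mem_univ_pi, Set.mem_Icc, abs_le]
    exact forall_congr' fun i => by constructor <;> rintro ⟨_, _⟩ <;> constructor <;> linarith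
  have bdd : ∀ u ∈ K, ∀ i, |u i| ≤ 2 := fun u hu i => by
    have h1 := (memK u).1 hu i
    have h2 := abs_add_le (u i - v i) (v i)
    rw [sub_add_cancel] at h2
    linarith [hv i]
  have hvK : v ∈ K := (memK v).2 fun i => by simpa using hr.le
  have cont : ContinuousOn (freeEnergy c) K := by
    refine ((continuousOn_poissonLog (by positivity)).mono bdd).sub (Continuous.continuousOn ?_)
    fun_prop
  obtain ⟨u, huK, hmin⟩ := (isCompact_univ_pi fun i => isCompact_Icc).exists_isMinOn ⟨v, hvK⟩ cont
  have hle : freeEnergy c u ≤ freeEnergy c v := hmin hvK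
  have hclose := (memK u).1 huK
  refine ⟨u, hclose, hle, fun i => ?_⟩
  have interior : |u i - v i| < r := by
    refine lt_of_le_of_ne (hclose i) fun heq => ?_
    have h1 := freeEnergy_ge hc (bdd u huK) (bdd v hvK) fun i => (hclose i).trans hr1
    have h2 : Real.exp (v i) * r ^ 2 ≤ ∑ i, Real.exp (v i) * (u i - v i) ^ 2 := by
      rw [← heq, sq_abs]
      exact single_le_sum (f := fun i => Real.exp (v i) * (u i - v i) ^ 2)
        (fun i _ => by positivity) (mem_univ i)
    have h3 := sum_gibbsMean (by positivity : 0 ≤ 2 * c) v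
    have h4 : ∀ j, 0 ≤ (gibbsMean (2 * c) v j - c * (1 - Real.exp (v j)) + ε) *
        (u j - v j + r) := fun j =>
      mul_nonneg (by linarith [hgrad j]) (by linarith [(abs_le.1 (hclose j)).1])
    have h5 : ∀ j, ε * (u j - v j) ≤ ε * r := fun j =>
      mul_le_mul_of_nonneg_left (le_of_abs_le (hclose j)) hε
    have h6 : -(6 * ε * r) ≤
        ∑ i, (gibbsMean (2 * c) v i - c * (1 - Real.exp (v i))) * (u i - v i) := by
      have h40 := h4 0
      have h41 := h4 1
      have h42 := h4 2
      have h50 := h5 0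
      have h51 := h5 1
      have h52 := h5 2
      rw [Fin.sum_univ_three] at h3 hsum ⊢
      have h7 : (gibbsMean (2 * c) v 0 - c * (1 - Real.exp (v 0)) +
          (gibbsMean (2 * c) v 1 - c * (1 - Real.exp (v 1))) +
          (gibbsMean (2 * c) v 2 - c * (1 - Real.exp (v 2)))) * r = 0 := by
        rw [show Real.exp (v 2) = 1 - Real.exp (v 0) - Real.exp (v 1) by linarith,
          show gibbsMean (2 * c) v 2 = 2 * c - gibbsMean (2 * c) v 0 - gibbsMean (2 * c) v 1 by
            linarith]
        ring
      linarith
    have h7 : c / 4 * (m * r ^ 2) ≤ c / 4 * ∑ i, Real.exp (v i) * (u i - v i) ^ 2 := by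
      refine mul_le_mul_of_nonneg_left (le_trans ?_ h2) (by positivity)
      exact mul_le_mul_of_nonneg_right (hm i) (by positivity)
    have h8 := mul_lt_mul_of_pos_right hsmall hr
    linarith
  have hlocal : IsLocalMin (fun t => freeEnergy c (Function.update u i t)) (u i) := by
    have hopen : ∀ᶠ t in nhds (u i), |t - v i| < r :=
      (continuous_id.sub continuous_const).abs.continuousAt.eventually_lt
        continuousAt_const interior
    filter_upwards [hopen] with t ht
    rw [Function.update_eq_self]
    refine hmin ((memK _).2 fun j => ?_)
    by_cases hj : j = i
    · subst hj; simpa using ht.le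
    · simpa [hj] using hclose j
  linarith [hlocal.hasDerivAt_eq_zero (hasDerivAt_freeEnergy hc (bdd u huK) i)]

end PoissonGibbs

section Numerics

open Finset

lemma log_le_of_le_pow {y s : ℝ} (hy : 0 < y) (hs : |s| ≤ 1)
    (h0 : 0 ≤ ∑ k ∈ range 14, s ^ k / k.factorial -
      |s| ^ 14 * ((14 : ℕ).succ / (Nat.factorial 14 * (14 : ℕ))))
    (h : y ≤ (∑ k ∈ range 14, s ^ k / k.factorial -
      |s| ^ 14 * ((14 : ℕ).succ / (Nat.factorial 14 * (14 : ℕ)))) ^ 16) :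
    Real.log y ≤ 16 * s := by
  rw [Real.log_le_iff_le_exp hy]
  have h1 := (abs_le.1 (Real.exp_bound hs (n := 14) (by norm_num))).1
  refine h.trans ?_
  have e : Real.exp (16 * s) = Real.exp s ^ 16 := by
    rw [← Real.exp_nat_mul]; norm_num
  rw [e]
  exact pow_le_pow_left₀ h0 (by linarith) 16

lemma exp_le_sum_add {x : ℝ} (hx : 0 ≤ x) {n : ℕ} (h : x / n.succ ≤ 1 / 2) :
    Real.exp x ≤ ∑ m ∈ range n, x ^ m / m.factorial + x ^ n / n.factorial * 2 := by
  have hb := Complex.exp_bound' (x := (x : ℂ)) (n := n) (by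
    rwa [Complex.norm_real, Real.norm_of_nonneg hx])
  rw [Complex.norm_real, Real.norm_of_nonneg hx] at hb
  have h2 := (Complex.abs_re_le_norm _).trans hb
  have e : (Complex.exp x - ∑ m ∈ range n, (x : ℂ) ^ m / m.factorial).re =
      Real.exp x - ∑ m ∈ range n, x ^ m / m.factorial := by
    rw [← Complex.ofReal_re (Real.exp x - ∑ m ∈ range n, x ^ m / m.factorial)]
    push_cast; rfl
  rw [e] at h2
  linarith [le_of_abs_le h2]

lemma exp_lam_le : Real.exp 4.93631 ≤ 139.25544774 := by
  refine (exp_le_sum_add (n := 28) (by norm_num) (by norm_num)).trans ?_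
  norm_num [sum_range_succ, Nat.factorial]

/-- Approximate values of `1 - 2 φ_i` at the solution. -/
noncomputable def approx : Fin 3 → ℝ := ![0.3360015009, 0.3333255270, 0.3306729721]

lemma approx_zero : approx 0 = 0.3360015009 := rfl

lemma approx_one : approx 1 = 0.3333255270 := rfl

lemma approx_two : approx 2 = 0.3306729721 := rfl

/-- The logarithms of `approx`. -/
noncomputable def approxLog (i : Fin 3) : ℝ := Real.log (approx i)

/-- Rational upper bounds for `log (partitionSum approxLog x)`. -/
noncomputable def logBound : ℕ → ℝ
  | 1 => -0.00534277604
  | 2 => -0.00351597783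
  | 3 => -0.25347274126
  | 4 => -0.58895287704
  | 5 => -0.96089570484
  | 6 => -1.34979542000
  | 7 => -1.74688609904
  | 8 => -2.14799746188
  | 9 => -2.55108995601
  | 10 => -2.95515239641
  | 11 => -3.35968004059
  | 12 => -3.76442009533
  | 13 => -4.16924574825
  | 14 => -4.57409334137
  | 15 => -4.97893091671
  | 16 => -5.38374243847
  | 17 => -5.78851987122
  | 18 => -6.19325920064
  | 19 => -6.59795843423
  | 20 => -7.00261659671
  | 21 => -7.40723322521
  | 22 => -7.81180811562
  | 23 => -8.21634119511
  | 24 => -8.62083245806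
  | 25 => -9.02528193387
  | _ => 0

lemma approx_bounds (i : Fin 3) : 0.33 ≤ approx i ∧ approx i ≤ 0.3361 := by
  fin_cases i <;> norm_num [approx]

lemma exp_approxLog (i : Fin 3) : Real.exp (approxLog i) = approx i :=
  Real.exp_log (by linarith [(approx_bounds i).1])

lemma partitionSum_approx {x : ℕ} (hx : 1 ≤ x) :
    partitionSum approxLog x = (2 ^ x - 2) * 0.3360015009 ^ x +
      (2 ^ x - 1) * 0.3333255270 ^ x + 2 ^ x * 0.3306729721 ^ x := by
  have h : (2 : ℝ) ≤ 2 ^ x := by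
    simpa using pow_le_pow_right₀ (one_le_two : (1 : ℝ) ≤ 2) hx
  simp only [partitionSum, Fin.sum_univ_three, exp_approxLog]
  simp [approx, weight, h]

lemma gibbs_approx_sum (i : Fin 3) :
    (2.468155 * (1 - approx i) - 0.000000001) * 139.25544774 ≤
      ∑ x ∈ range 26, 4.93631 ^ x / x.factorial *
        (x * gibbs approxLog i x) := by
  rw [sum_range_succ']
  have h : ∀ k : ℕ, (2 : ℝ) ≤ 2 ^ (k + 1) := fun k => by
    simpa using pow_le_pow_right₀ (one_le_two : (1 : ℝ) ≤ 2) (Nat.succ_le_succ k.zero_le)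
  fin_cases i <;>
    simp only [gibbs, exp_approxLog, partitionSum_approx (Nat.succ_le_succ (Nat.zero_le _)),
      Fin.zero_eta, Fin.mk_one, Fin.reduceFinMk, approx, weight, Matrix.cons_val]
  · simp only [max_eq_right (sub_nonneg.2 (h _))]
    norm_num [sum_range_succ, Nat.factorial]
  · norm_num [sum_range_succ, Nat.factorial]
  · norm_num [sum_range_succ, Nat.factorial]

lemma log_partitionSum_approx_le {x : ℕ} (hx : x < 26) :
    Real.log (partitionSum approxLog x) ≤ logBound x := by
  rcases Nat.eq_zero_or_pos x with rfl | h
  · simp [partitionSum, weight, Fin.sum_univ_three, logBound]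
  · have hpos := partitionSum_pos approxLog x
    have key := fun h1 h2 h3 => log_le_of_le_pow (s := logBound x / 16) hpos h1 h2 h3
    rw [mul_div_cancel₀ _ (by norm_num)] at key
    rw [partitionSum_approx h] at key ⊢
    interval_cases x <;> simp only [logBound] at key ⊢ <;> apply key <;>
      norm_num [sum_range_succ, Nat.factorial, abs_of_neg]

lemma logBound_sum : ∑ x ∈ range 26, 4.93631 ^ x / x.factorial * logBound x ≤
    -1.00101359 * 139.25544774 := by
  norm_num [sum_range_succ, Nat.factorial, logBound]

end Numerics

section Solution

open Finset

lemma exp_neg_lam_ge : (139.25544774 : ℝ)⁻¹ ≤ Real.exp (-4.93631) := by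
  rw [Real.exp_neg]
  exact inv_anti₀ (Real.exp_pos _) exp_lam_le

lemma gibbsMean_approx_ge (i : Fin 3) :
    2.468155 * (1 - Real.exp (approxLog i)) - 0.000000001 ≤ gibbsMean (2 * 2.468155) approxLog i := by
  have h1 := (summable_mul_poisson_gibbs (by norm_num : (0 : ℝ) ≤ 4.93631) approxLog i).sum_le_tsum
    (range 26) fun x _ => mul_nonneg (mul_nonneg x.cast_nonneg (poisson_nonneg (by norm_num) x))
      (gibbs_nonneg approxLog i x)
  rw [show (2 : ℝ) * 2.468155 = 4.93631 by norm_num, exp_approxLog]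
  refine le_trans ?_ h1
  have e : ∑ x ∈ range 26, (x : ℝ) * poisson 4.93631 x * gibbs approxLog i x =
      Real.exp (-4.93631) * ∑ x ∈ range 26, 4.93631 ^ x / x.factorial *
        (x * gibbs approxLog i x) := by
    rw [mul_sum]
    exact sum_congr rfl fun x _ => by rw [poisson_eq]; ring
  have h2 := gibbs_approx_sum i
  have h3 : (0 : ℝ) ≤ 2.468155 * (1 - approx i) - 0.000000001 := by linarith [(approx_bounds i).2]
  rw [e]
  calc _ = (139.25544774 : ℝ)⁻¹ * ((2.468155 * (1 - approx i) - 0.000000001) * 139.25544774) := by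
        field_simp
    _ ≤ _ := mul_le_mul exp_neg_lam_ge h2 (by positivity) (Real.exp_pos _).le

lemma partitionSum_approx_le_one {x : ℕ} (hx : 3 ≤ x) : partitionSum approxLog x ≤ 1 := by
  have h : ∀ i ∈ (univ : Finset (Fin 3)),
      weight i x * Real.exp (approxLog i) ^ x ≤ (0.68 : ℝ) ^ 3 := fun i _ => by
    have hb := approx_bounds i
    rw [exp_approxLog]
    calc weight i x * approx i ^ x ≤ 2 ^ x * 0.34 ^ x :=
          mul_le_mul (weight_le i x) (pow_le_pow_left₀ (by linarith) (by linarith) x)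
            (pow_nonneg (by linarith) x) (by positivity)
      _ = (0.68 : ℝ) ^ x := by rw [← mul_pow]; norm_num
      _ ≤ 0.68 ^ 3 := pow_le_pow_of_le_one (by norm_num) (by norm_num) hx
  refine (sum_le_sum h).trans ?_
  norm_num

lemma approxLog_lower : -1.0906396523 ≤ approxLog 0 ∧ -1.0986357081 ≤ approxLog 1 ∧
    -1.1066253918 ≤ approxLog 2 := by
  have key : ∀ {y t : ℝ}, Real.log y⁻¹ ≤ 16 * (-t / 16) → t ≤ Real.log y := by
    intro y t h
    rw [Real.log_inv] at h
    linarith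
  simp only [approxLog]
  refine ⟨?_, ?_, ?_⟩ <;>
    refine key (log_le_of_le_pow (by norm_num [approx_zero, approx_one, approx_two]) ?_ ?_ ?_) <;>
    norm_num [sum_range_succ, Nat.factorial, approx_zero, approx_one, approx_two, abs_of_pos]

lemma approxLog_bounds (i : Fin 3) : -1.1086 ≤ approxLog i ∧ approxLog i ≤ -1.0886 := by
  obtain ⟨l0, l1, l2⟩ := approxLog_lower
  constructor
  · fin_cases i <;> simp only [Fin.zero_eta, Fin.mk_one, Fin.reduceFinMk] <;> linarith
  · have h : Real.log 0.3361 ≤ 16 * (-1.0886 / 16) := by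
      refine log_le_of_le_pow (by norm_num) ?_ ?_ ?_ <;>
        norm_num [sum_range_succ, Nat.factorial, abs_of_neg]
    have := Real.log_le_log (by linarith [approx_bounds i]) (approx_bounds i).2
    rw [approxLog]
    linarith

lemma poissonLog_approx_le : poissonLog (2 * 2.468155) approxLog ≤ -1.00101359 := by
  rw [show (2 : ℝ) * 2.468155 = 4.93631 by norm_num]
  have hbd : ∀ i, |approxLog i| ≤ 2 := fun i => by
    have h := approxLog_bounds i
    rw [abs_le]; constructor <;> linarith
  have h1 := (summable_poisson_log (by norm_num : (0 : ℝ) ≤ 4.93631) hbd).neg.sum_le_tsum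
    (range 26) fun x hx => by
      rw [mem_range, not_lt] at hx
      have := Real.log_nonpos (partitionSum_pos approxLog x).le
        (partitionSum_approx_le_one (by omega))
      exact neg_nonneg.2 (mul_nonpos_of_nonneg_of_nonpos (poisson_nonneg (by norm_num) x) this)
  rw [tsum_neg, sum_neg_distrib, neg_le_neg_iff] at h1
  refine h1.trans ?_
  have h2 : ∑ x ∈ range 26, poisson 4.93631 x * Real.log (partitionSum approxLog x) ≤
      Real.exp (-4.93631) * ∑ x ∈ range 26, 4.93631 ^ x / x.factorial * logBound x := by
    rw [mul_sum]
    refine sum_le_sum fun x hx => ?_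
    rw [poisson_eq, mul_assoc]
    have := log_partitionSum_approx_le (mem_range.1 hx)
    gcongr
  have h3 := mul_le_mul_of_nonneg_left logBound_sum (Real.exp_pos (-4.93631)).le
  have h4 := exp_neg_lam_ge
  rw [inv_le_iff_one_le_mul₀ (by norm_num)] at h4
  linarith

lemma mul_exp_le_of_close {a b : ℝ} {r : ℝ} (h : |b - a| ≤ r) (hr : r ≤ 1)
    (ha : |a + 1.0986| ≤ 0.01) (hq : Real.exp a ≤ 0.34) :
    Real.exp b * b ≤
      Real.exp a * a + (Real.exp b - Real.exp a) * (1 - 1.0986) + 0.68 * r * (0.01 + r) := by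
  have e : Real.exp b = Real.exp a * Real.exp (b - a) := by
    rw [← Real.exp_add]; congr 1; ring
  have hpos := Real.exp_pos a
  have h1 : Real.exp a * (b - a) ≤ Real.exp b - Real.exp a := by
    rw [e]
    nlinarith [Real.add_one_le_exp (b - a)]
  have h2 : |Real.exp b - Real.exp a| ≤ 0.68 * r := by
    have h3 := Real.abs_exp_sub_one_le (h.trans hr)
    rw [show Real.exp b - Real.exp a = Real.exp a * (Real.exp (b - a) - 1) by rw [e]; ring,
      abs_mul, abs_of_pos hpos]
    nlinarith [abs_nonneg (Real.exp (b - a) - 1)]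
  have h3 : (Real.exp b - Real.exp a) * ((a + 1.0986) + (b - a)) ≤ 0.68 * r * (0.01 + r) := by
    refine (le_abs_self _).trans ?_
    rw [abs_mul]
    exact mul_le_mul h2 ((abs_add_le _ _).trans (add_le_add ha h)) (abs_nonneg _)
      ((abs_nonneg _).trans h2)
  linarith

lemma exponent_neg {u : Fin 3 → ℝ} (hu : ∀ i, |u i - approxLog i| ≤ 0.0000001)
    (hsum : ∑ i, Real.exp (u i) = 1)
    (hle : freeEnergy 2.468155 u ≤ freeEnergy 2.468155 approxLog) :
    poissonLog (2 * 2.468155) u - 2.468155 * Real.log 2 +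
      2.468155 * ∑ i, (2 * Real.exp (u i) - 1) * u i < 0 := by
  have h1 := fun i => mul_exp_le_of_close (hu i) (by norm_num)
    (abs_le.2 (by have := approxLog_bounds i; constructor <;> linarith))
    (by rw [exp_approxLog]; linarith [(approx_bounds i).2])
  have h10 := h1 0
  have h11 := h1 1
  have h12 := h1 2
  have hL := poissonLog_approx_le
  have h2 := Real.log_two_gt_d9
  obtain ⟨l0, l1, l2⟩ := approxLog_lower
  simp only [freeEnergy, Fin.sum_univ_three, exp_approxLog] at hsum hle h10 h11 h12 ⊢
  norm_num [approx_zero, approx_one, approx_two] at hle h10 h11 h12 hL h2 l0 l1 l2 ⊢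
  linarith

end Solution

/-- For `c = 2.468155` and `λ = 2c` there is a solution `(φ0, φ1)` (with
`φ2 = 1 − φ0 − φ1`, all in `(0.26, 0.4)`) of the fixed-point system for which
`2^(−c) exp(Σ_x p_x log B(x,φ)) ∏_i (1 − 2φ_i)^((1 − 4φ_i) c) < 1`. -/
theorem stmt11 :
    ∀ c : ℝ, c = 2.468155 →
    ∃ phi0 phi1 : ℝ, ∀ phi2 : ℝ, phi2 = 1 - phi0 - phi1 →
      (0.26 < phi0 ∧ phi0 < 0.4) ∧ (0.26 < phi1 ∧ phi1 < 0.4) ∧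
      (0.26 < phi2 ∧ phi2 < 0.4) ∧
      (2 * c) * phi0 = (∑' x : ℕ, (x : ℝ) * poisson (2 * c) x *
          A0 phi0 x / B phi0 phi1 phi2 x) ∧
      (2 * c) * phi1 = (∑' x : ℕ, (x : ℝ) * poisson (2 * c) x *
          A1 phi1 x / B phi0 phi1 phi2 x) ∧
      (2 : ℝ) ^ (-c) *
          Real.exp (∑' x : ℕ, poisson (2 * c) x * Real.log (B phi0 phi1 phi2 x)) *
          (1 - 2 * phi0) ^ ((1 - 4 * phi0) * c) *
          (1 - 2 * phi1) ^ ((1 - 4 * phi1) * c) *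
          (1 - 2 * phi2) ^ ((1 - 4 * phi2) * c) < 1 := by
  rintro c rfl
  obtain ⟨u, hclose, hle, hcrit⟩ := exists_critical (c := 2.468155) (r := 0.0000001) (ε := 0.000000001)
    (m := 0.33) (v := approxLog) (by norm_num) (by norm_num) (by norm_num) (by norm_num)
    (fun i => by
      have h := approxLog_bounds i
      rw [← le_sub_iff_add_le, abs_le]; constructor <;> linarith)
    (fun i => by rw [exp_approxLog]; exact (approx_bounds i).1)
    (by simp only [exp_approxLog, Fin.sum_univ_three]; norm_num [approx_zero, approx_one, approx_two])
    gibbsMean_approx_ge (by norm_num)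
  have hsum : ∑ i, Real.exp (u i) = 1 := by
    have h := sum_gibbsMean (by norm_num : (0 : ℝ) ≤ 2 * 2.468155) u
    simp only [hcrit, Fin.sum_univ_three] at h ⊢
    linarith
  have hrange : ∀ i, 0.3 < Real.exp (u i) ∧ Real.exp (u i) < 0.4 := fun i => by
    have h3 := Real.abs_exp_sub_one_le ((hclose i).trans (by norm_num))
    have e : Real.exp (u i) = approx i * Real.exp (u i - approxLog i) := by
      rw [← exp_approxLog, ← Real.exp_add]; congr 1; ring
    have h4 := abs_le.1 (h3.trans (mul_le_mul_of_nonneg_left (hclose i) zero_le_two))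
    have hb := approx_bounds i
    rw [e]
    constructor <;> nlinarith
  have hneg := exponent_neg hclose hsum hle
  have hq : ∀ i, 1 - 2 * ((1 - Real.exp (u i)) / 2) = Real.exp (u i) := fun i => by ring
  have hq4 : ∀ i, 1 - 4 * ((1 - Real.exp (u i)) / 2) = 2 * Real.exp (u i) - 1 := fun i => by ring
  refine ⟨(1 - Real.exp (u 0)) / 2, (1 - Real.exp (u 1)) / 2, fun phi2 h2 => ?_⟩
  obtain rfl : phi2 = (1 - Real.exp (u 2)) / 2 := by
    rw [Fin.sum_univ_three] at hsum
    rw [h2]; linarith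
  have hB : ∀ x, B ((1 - Real.exp (u 0)) / 2) ((1 - Real.exp (u 1)) / 2)
      ((1 - Real.exp (u 2)) / 2) x = partitionSum u x := fun x => by
    simp only [B, A0, A1, A2, hq, partitionSum, Fin.sum_univ_three]
    rfl
  refine ⟨?_, ?_, ?_, ?_, ?_, ?_⟩
  · constructor <;> linarith [hrange 0]
  · constructor <;> linarith [hrange 1]
  · constructor <;> linarith [hrange 2]
  · have h := hcrit 0
    simp only [gibbsMean, gibbs, ← mul_div_assoc] at h
    simp only [hB, A0, hq]
    exact (by ring : _ = _).trans h.symm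
  · have h := hcrit 1
    simp only [gibbsMean, gibbs, ← mul_div_assoc] at h
    simp only [hB, A1, hq]
    exact (by ring : _ = _).trans h.symm
  · simp only [hB, hq, hq4, ← Real.exp_mul]
    rw [Real.rpow_def_of_pos two_pos]
    simp only [← Real.exp_add]
    rw [Real.exp_lt_one_iff]
    simp only [poissonLog, Fin.sum_univ_three] at hneg
    linarith
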